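/- Sign dichotomy for the sine-Gordon potentials (Step 1 of the sine-Gordon corollary): Let X be a topological space whose underlying set is preconnected (IsPreconnected (Set.univ)), let q₁, q₂, u₁, u₂ : X → ℝ be functions such that the difference ψ := u₂ − u₁ is continuous on X, such that q₂ x ≠ 0 for every x ∈ X, and such that for every x ∈ X: q₁ x * Real.cos (u₁ x) = q₂ x * Real.cos (u₂ x) and q₁ x * Real.sin (u₁ x) = q₂ x * Real.sin (u₂ x). Then either q₁ x = q₂ x for every x ∈ X, or q₁ x = −q₂ x for every x ∈ X. -/

import Mathlib

theorem sineGordon_sign_dichotomy {X : Type*} [TopologicalSpace X]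
    (hX : IsPreconnected (Set.univ : Set X))
    (q₁ q₂ u₁ u₂ : X → ℝ)
    (hψ : Continuous (fun x => u₂ x - u₁ x))
    (hq₂ : ∀ x, q₂ x ≠ 0)
    (hcos : ∀ x, q₁ x * Real.cos (u₁ x) = q₂ x * Real.cos (u₂ x))
    (hsin : ∀ x, q₁ x * Real.sin (u₁ x) = q₂ x * Real.sin (u₂ x)) :
    (∀ x, q₁ x = q₂ x) ∨ (∀ x, q₁ x = -q₂ x) := by
  have h1 : ∀ x, q₁ x = q₂ x * Real.cos (u₂ x - u₁ x) := by
    intro x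
    rw [Real.cos_sub]
    linear_combination Real.cos (u₁ x) * hcos x + Real.sin (u₁ x) * hsin x
      - q₁ x * Real.sin_sq_add_cos_sq (u₁ x)
  have h2 : ∀ x, Real.sin (u₂ x - u₁ x) = 0 := by
    intro x
    apply mul_left_cancel₀ (hq₂ x)
    rw [Real.sin_sub]
    linear_combination Real.sin (u₁ x) * hcos x - Real.cos (u₁ x) * hsin x
  have hc : Continuous (fun x => Real.cos (u₂ x - u₁ x)) := Real.continuous_cos.comp hψ
  have hsq : Set.EqOn ((fun x => Real.cos (u₂ x - u₁ x)) ^ 2) 1 Set.univ := by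
    intro x _
    have h := Real.sin_sq_add_cos_sq (u₂ x - u₁ x)
    rw [h2 x] at h
    simpa using h
  rcases hX.eq_one_or_eq_neg_one_of_sq_eq hc.continuousOn hsq with h | h
  · left
    intro x
    have hx : Real.cos (u₂ x - u₁ x) = 1 := h (Set.mem_univ x)
    rw [h1 x, hx, mul_one]
  · right
    intro x
    have hx : Real.cos (u₂ x - u₁ x) = -1 := h (Set.mem_univ x)
    rw [h1 x, hx, mul_neg, mul_one]
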